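/- Let P be a left cancellative monoid. If X, Y ∈ J(P), then X ∩ Y ∈ J(P). -/

import Mathlib

open Set

/-- Image of `X` under left multiplication by `p`: `pX = {p*x : x ∈ X}`. -/
def imgMul {P : Type*} [Monoid P] (p : P) (X : Set P) : Set P :=
  (fun x => p * x) '' X

/-- Preimage of `X` under left multiplication by `q`: `q⁻¹X = {r : q*r ∈ X}`. -/
def preMul {P : Type*} [Monoid P] (q : P) (X : Set P) : Set P :=
  (fun x => q * x) ⁻¹' X

/-- The constructible right ideals
`J(P) = {p₁⁻¹q₁⋯pₙ⁻¹qₙP : n ≥ 1, pᵢ,qᵢ ∈ P} ∪ {∅}`. -/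
def JP (P : Type*) [Monoid P] : Set (Set P) :=
  {X | X = ∅ ∨ ∃ l : List (P × P), l ≠ [] ∧
    X = l.foldr (fun pq Y => preMul pq.1 (imgMul pq.2 Y)) Set.univ}

/-- The chain map `g(X) = qₙ⁻¹(pₙ(⋯(q₁⁻¹(p₁X))⋯))` associated to the list
`[(p₁,q₁),…,(pₙ,qₙ)]`. -/
def chainMap {P : Type*} [Monoid P] (l : List (P × P)) (X : Set P) : Set P :=
  l.foldl (fun Y pq => preMul pq.2 (imgMul pq.1 Y)) X

/-- `φ : Set P → ℝ` satisfies the ∨-condition if for all `X, Y ∈ J(P)` with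
`X ∪ Y ∈ J(P)` one has `φ(X ∪ Y) = φ(X) + φ(Y) − φ(X ∩ Y)`. -/
def VeeCond {P : Type*} [Monoid P] (φ : Set P → ℝ) : Prop :=
  ∀ X ∈ JP P, ∀ Y ∈ JP P, X ∪ Y ∈ JP P → φ (X ∪ Y) = φ X + φ Y - φ (X ∩ Y)

/-- A character: `φ(X) ∈ {0,1}` for `X ∈ J(P)`, `φ(P) = 1`, `φ(∅) = 0`, and
`φ(X ∩ Y) = φ(X)·φ(Y)` for all `X, Y ∈ J(P)`. -/
def IsCharacter {P : Type*} [Monoid P] (φ : Set P → ℝ) : Prop :=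
  (∀ X ∈ JP P, φ X = 0 ∨ φ X = 1) ∧ φ (Set.univ : Set P) = 1 ∧
    φ (∅ : Set P) = 0 ∧ ∀ X ∈ JP P, ∀ Y ∈ JP P, φ (X ∩ Y) = φ X * φ Y

theorem preMul_imgMul_mem_JP {P : Type*} [Monoid P] (p q : P) {X : Set P} (hX : X ∈ JP P) :
    preMul p (imgMul q X) ∈ JP P := by
  rcases hX with rfl | ⟨l, -, rfl⟩
  · left
    simp [preMul, imgMul]
  · exact Or.inr ⟨(p, q) :: l, by simp, rfl⟩

theorem preMul_imgMul_inter {P : Type*} [Monoid P]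
    (hP : ∀ p x y : P, p * x = p * y → x = y) (p q : P) (X Y : Set P) :
    preMul p (imgMul q X) ∩ Y = preMul p (imgMul q (X ∩ preMul q (imgMul p Y))) := by
  ext r
  constructor
  · rintro ⟨⟨x, hx, hxr⟩, hr⟩
    exact ⟨x, ⟨hx, r, hr, hxr.symm⟩, hxr⟩
  · rintro ⟨x, ⟨hx, y, hy, hyx⟩, hxr⟩
    obtain rfl : y = r := hP p y r (hyx.trans hxr)
    exact ⟨⟨x, hx, hxr⟩, hy⟩

theorem foldr_inter_mem_JP {P : Type*} [Monoid P]
    (hP : ∀ p x y : P, p * x = p * y → x = y) (l : List (P × P)) {Y : Set P} (hY : Y ∈ JP P) :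
    l.foldr (fun pq Z => preMul pq.1 (imgMul pq.2 Z)) Set.univ ∩ Y ∈ JP P := by
  induction l generalizing Y with
  | nil => simpa using hY
  | cons a l ih =>
    rw [List.foldr_cons, preMul_imgMul_inter hP]
    exact preMul_imgMul_mem_JP _ _ (ih (preMul_imgMul_mem_JP _ _ hY))

theorem stmt_4 {P : Type*} [Monoid P]
    (hP : ∀ p x y : P, p * x = p * y → x = y)
    (X Y : Set P) (hX : X ∈ JP P) (hY : Y ∈ JP P) :
    X ∩ Y ∈ JP P := by
  rcases hX with rfl | ⟨l, -, rfl⟩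
  · left
    exact Set.empty_inter Y
  · exact foldr_inter_mem_JP hP l hY
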